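/- arXiv:1804.05489 — 2 statements merged into one kernel-verified Lean document; each statement's English description precedes it below -/
import Mathlib

section
/- Let V : ℝ^d → ℝ be C¹ with |∇V(x)| ≤ C⟨x⟩^{-2}, and suppose there are c₁ > c₂ > 0 and R > 0 such that for |x| ≥ R, the radial derivative satisfies |∂_r V(x)| = |x̂·∇V(x)| ≥ c₁/|x|² (with constant sign, say ∂_r V ≥ c₁/|x|²) and the tangential part satisfies |∇V(x) − (x̂·∇V(x))x̂| ≤ c₂/|x|². Then there exists c₃ > 0 such that for all unit ξ and x ⊥ ξ with |x| ≥ R, ψ(x,ξ) = ∫_{-∞}^{∞}(V(x+tξ) − V(tξ))dt ≥ 2(c₁ − c₂)log|x| − c₃. -/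
open MeasureTheory
open scoped RealInnerProductSpace

section Line

variable {E : Type*} [NormedAddCommGroup E] [InnerProductSpace ℝ E]

theorem norm_smul_add_smul_sq_of_inner_eq_zero {x ξ : E} (hξ : ‖ξ‖ = 1) (hxξ : ⟪x, ξ⟫ = 0)
    (s t : ℝ) : ‖s • x + t • ξ‖ ^ 2 = s ^ 2 * ‖x‖ ^ 2 + t ^ 2 := by
  rw [norm_add_sq_real, real_inner_smul_left, real_inner_smul_right, hxξ, norm_smul, norm_smul, hξ]
  simp [mul_pow]

theorem inner_ge_of_radial_ge_of_tangential_le {x ξ G : E} {c₁ c₂ s t n : ℝ} (hξ : ‖ξ‖ = 1)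
    (hxξ : ⟪x, ξ⟫ = 0) (hs : 0 ≤ s) (ht : 0 < t) (hn : n = ‖s • x + t • ξ‖)
    (hrad : ⟪n⁻¹ • (s • x + t • ξ), G⟫ ≥ c₁ / n ^ 2)
    (htan : ‖G - ⟪n⁻¹ • (s • x + t • ξ), G⟫ • (n⁻¹ • (s • x + t • ξ))‖ ≤ c₂ / n ^ 2) :
    c₁ * s * ‖x‖ ^ 2 / n ^ 3 - c₂ * ‖x‖ * t / n ^ 3 ≤ ⟪x, G⟫ := by
  have hn2 : n ^ 2 = s ^ 2 * ‖x‖ ^ 2 + t ^ 2 := by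
    rw [hn]; exact norm_smul_add_smul_sq_of_inner_eq_zero hξ hxξ s t
  have hn0 : 0 < n := by
    have h0 : 0 ≤ n := hn ▸ norm_nonneg _
    have : 0 < n ^ 2 := by rw [hn2]; positivity
    exact lt_of_le_of_ne h0 (by rintro rfl; simp at this)
  have hxu : ⟪x, n⁻¹ • (s • x + t • ξ)⟫ = s * ‖x‖ ^ 2 / n := by
    rw [real_inner_smul_right, inner_add_right, real_inner_smul_right, real_inner_smul_right, hxξ,
      real_inner_self_eq_norm_sq]
    ring
  have hu : ‖n⁻¹ • (s • x + t • ξ)‖ = 1 := by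
    rw [norm_smul, ← hn, Real.norm_of_nonneg (by positivity)]
    field_simp
  set u := n⁻¹ • (s • x + t • ξ) with hudef
  set g := ⟪u, G⟫ with hg
  have huu : ⟪u, u⟫ = 1 := by rw [real_inner_self_eq_norm_sq, hu]; norm_num
  have huw : ⟪u, G - g • u⟫ = 0 := by
    rw [inner_sub_right, real_inner_smul_right, huu, ← hg]; ring
  have hdecomp : ⟪x, G⟫ = g * (s * ‖x‖ ^ 2 / n) + ⟪x - (s * ‖x‖ ^ 2 / n) • u, G - g • u⟫ := by
    rw [inner_sub_left, real_inner_smul_left, huw, inner_sub_right, real_inner_smul_right, hxu]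
    ring
  have hperp : ‖x - (s * ‖x‖ ^ 2 / n) • u‖ = ‖x‖ * t / n := by
    rw [← sq_eq_sq₀ (norm_nonneg _) (by positivity), norm_sub_sq_real, real_inner_smul_right, hxu,
      norm_smul, hu, mul_one, Real.norm_eq_abs, sq_abs]
    have : t ^ 2 = n ^ 2 - s ^ 2 * ‖x‖ ^ 2 := by linarith
    rw [div_pow (‖x‖ * t), mul_pow, this]
    field_simp
    ring
  have h1 : -(‖x‖ * t / n * (c₂ / n ^ 2)) ≤ ⟪x - (s * ‖x‖ ^ 2 / n) • u, G - g • u⟫ := by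
    refine le_trans (neg_le_neg ?_) (neg_le_of_abs_le (abs_real_inner_le_norm _ _))
    rw [hperp]
    gcongr
  have h2 : c₁ / n ^ 2 * (s * ‖x‖ ^ 2 / n) ≤ g * (s * ‖x‖ ^ 2 / n) :=
    mul_le_mul_of_nonneg_right hrad (by positivity)
  rw [hdecomp]
  calc _ = c₁ / n ^ 2 * (s * ‖x‖ ^ 2 / n) + -(‖x‖ * t / n * (c₂ / n ^ 2)) := by
        field_simp; ring
    _ ≤ _ := add_le_add h2 h1

theorem sub_le_sub_of_deriv_le_of_mem_Icc {f g f' g' : ℝ → ℝ}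
    (hf : ∀ s, HasDerivAt f (f' s) s) (hg : ∀ s, HasDerivAt g (g' s) s)
    (h : ∀ s, 0 ≤ s → g' s ≤ f' s) : g 1 - g 0 ≤ f 1 - f 0 := by
  have hd : ∀ s, HasDerivAt (fun s ↦ f s - g s) (f' s - g' s) s := fun s ↦ (hf s).sub (hg s)
  have hm : MonotoneOn (fun s ↦ f s - g s) (Set.Ici 0) := by
    refine monotoneOn_of_deriv_nonneg (convex_Ici 0)
      (fun s _ ↦ (hd s).continuousAt.continuousWithinAt)
      (fun s _ ↦ (hd s).differentiableAt.differentiableWithinAt) fun s hs ↦ ?_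
    rw [interior_Ici] at hs
    rw [(hd s).deriv]
    exact sub_nonneg.2 (h s (le_of_lt hs))
  have := hm (Set.mem_Ici.2 le_rfl) (Set.mem_Ici.2 zero_le_one) zero_le_one
  simp only at this
  linarith

variable [CompleteSpace E]

theorem hasDerivAt_comp_smul_add {V : E → ℝ} (hV : Differentiable ℝ V) (x y : E) (s : ℝ) :
    HasDerivAt (fun s : ℝ ↦ V (s • x + y)) ⟪x, gradient V (s • x + y)⟫ s := by
  have h1 : HasDerivAt (fun s : ℝ ↦ s • x + y) x s := by
    simpa using ((hasDerivAt_id s).smul_const x).add_const y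
  have h2 := (hV (s • x + y)).hasGradientAt.hasFDerivAt.comp_hasDerivAt s h1
  exact h2.congr_deriv (by simp)

variable {V : E → ℝ} {C : ℝ} {x ξ : E}

theorem abs_inner_gradient_le (hdecay : ∀ x, ‖gradient V x‖ ≤ C / (1 + ‖x‖ ^ 2)) (hξ : ‖ξ‖ = 1)
    (hxξ : ⟪x, ξ⟫ = 0) (s t : ℝ) :
    |⟪x, gradient V (s • x + t • ξ)⟫| ≤ ‖x‖ * (C / (1 + (s ^ 2 * ‖x‖ ^ 2 + t ^ 2))) := by
  refine (abs_real_inner_le_norm _ _).trans ?_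
  rw [← norm_smul_add_smul_sq_of_inner_eq_zero hξ hxξ s t]
  exact mul_le_mul_of_nonneg_left (hdecay _) (norm_nonneg _)

theorem nonneg_of_norm_gradient_le (hdecay : ∀ x, ‖gradient V x‖ ≤ C / (1 + ‖x‖ ^ 2)) : 0 ≤ C := by
  simpa using (norm_nonneg _).trans (hdecay 0)

theorem abs_sub_le_of_norm_gradient_le (hV : Differentiable ℝ V)
    (hdecay : ∀ x, ‖gradient V x‖ ≤ C / (1 + ‖x‖ ^ 2)) (hξ : ‖ξ‖ = 1) (hxξ : ⟪x, ξ⟫ = 0) (t : ℝ) :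
    |V (x + t • ξ) - V (t • ξ)| ≤ ‖x‖ * C * (1 + t ^ 2)⁻¹ := by
  have hC := nonneg_of_norm_gradient_le hdecay
  have hf := hasDerivAt_comp_smul_add hV x (t • ξ)
  have hb : ∀ s : ℝ, |⟪x, gradient V (s • x + t • ξ)⟫| ≤ ‖x‖ * C * (1 + t ^ 2)⁻¹ := fun s ↦ by
    refine (abs_inner_gradient_le hdecay hξ hxξ s t).trans ?_
    rw [mul_assoc, ← div_eq_mul_inv]
    gcongr
    nlinarith [sq_nonneg (s * ‖x‖)]
  have hlin : ∀ a s : ℝ, HasDerivAt (fun s ↦ s * a) a s := fun a s ↦ by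
    simpa using (hasDerivAt_id s).mul_const a
  have h1 := sub_le_sub_of_deriv_le_of_mem_Icc hf (hlin (-(‖x‖ * C * (1 + t ^ 2)⁻¹)))
    fun s _ ↦ neg_le_of_abs_le (hb s)
  have h2 := sub_le_sub_of_deriv_le_of_mem_Icc (hlin (‖x‖ * C * (1 + t ^ 2)⁻¹)) hf
    fun s _ ↦ le_of_abs_le (hb s)
  simp only [one_smul, zero_smul, zero_add, one_mul, zero_mul, sub_zero] at h1 h2
  exact abs_le.2 ⟨h1, h2⟩

theorem integrable_sub_of_norm_gradient_le (hV : Differentiable ℝ V)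
    (hdecay : ∀ x, ‖gradient V x‖ ≤ C / (1 + ‖x‖ ^ 2)) (hξ : ‖ξ‖ = 1) (hxξ : ⟪x, ξ⟫ = 0) :
    Integrable fun t : ℝ ↦ V (x + t • ξ) - V (t • ξ) := by
  have hc := hV.continuous
  refine (integrable_inv_one_add_sq.const_mul (‖x‖ * C)).mono'
    (by fun_prop : Continuous fun t : ℝ ↦ V (x + t • ξ) - V (t • ξ)).aestronglyMeasurable ?_
  exact Filter.Eventually.of_forall fun t ↦ abs_sub_le_of_norm_gradient_le hV hdecay hξ hxξ t

theorem neg_mul_pi_div_two_le_sub (hV : Differentiable ℝ V)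
    (hdecay : ∀ x, ‖gradient V x‖ ≤ C / (1 + ‖x‖ ^ 2)) (hξ : ‖ξ‖ = 1) (hxξ : ⟪x, ξ⟫ = 0) (t : ℝ) :
    -(C * (Real.pi / 2)) ≤ V (x + t • ξ) - V (t • ξ) := by
  have hC := nonneg_of_norm_gradient_le hdecay
  have hf := hasDerivAt_comp_smul_add hV x (t • ξ)
  have hg : ∀ s : ℝ, HasDerivAt (fun s ↦ -C * Real.arctan (s * ‖x‖))
      (-C * (1 / (1 + (s * ‖x‖) ^ 2) * ‖x‖)) s := fun s ↦ by
    have : HasDerivAt (fun s : ℝ ↦ s * ‖x‖) ‖x‖ s := by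
      simpa using (hasDerivAt_id s).mul_const ‖x‖
    exact this.arctan.const_mul _
  have h := sub_le_sub_of_deriv_le_of_mem_Icc hf hg fun s _ ↦ by
    refine le_trans ?_ (neg_le_of_abs_le (abs_inner_gradient_le hdecay hξ hxξ s t))
    have : ‖x‖ * (C / (1 + (s ^ 2 * ‖x‖ ^ 2 + t ^ 2))) ≤ ‖x‖ * (C / (1 + (s * ‖x‖) ^ 2)) := by
      gcongr
      nlinarith [sq_nonneg t]
    calc _ = -(‖x‖ * (C / (1 + (s * ‖x‖) ^ 2))) := by ring
      _ ≤ _ := neg_le_neg this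
  simp only [one_smul, zero_smul, zero_add, one_mul, zero_mul, Real.arctan_zero, mul_zero,
    sub_zero] at h
  nlinarith [Real.arctan_lt_pi_div_two ‖x‖]

variable {c₁ c₂ R : ℝ}

theorem sub_ge_of_radial_ge_of_tangential_le (hV : Differentiable ℝ V) (hR : 0 < R)
    (hrad : ∀ x : E, R ≤ ‖x‖ → ⟪‖x‖⁻¹ • x, gradient V x⟫ ≥ c₁ / ‖x‖ ^ 2)
    (htan : ∀ x : E, R ≤ ‖x‖ →
      ‖gradient V x - ⟪‖x‖⁻¹ • x, gradient V x⟫ • (‖x‖⁻¹ • x)‖ ≤ c₂ / ‖x‖ ^ 2)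
    (hξ : ‖ξ‖ = 1) (hxξ : ⟪x, ξ⟫ = 0) {t : ℝ} (ht : R ≤ t) :
    c₁ / t - c₁ / √(‖x‖ ^ 2 + t ^ 2) - c₂ * ‖x‖ / (t * √(‖x‖ ^ 2 + t ^ 2)) ≤
      V (x + t • ξ) - V (t • ξ) := by
  have ht0 : 0 < t := hR.trans_le ht
  have hf := hasDerivAt_comp_smul_add hV x (t • ξ)
  have hpos : ∀ s : ℝ, 0 < s ^ 2 * ‖x‖ ^ 2 + t ^ 2 := fun s ↦ by positivity
  have hρ : ∀ s : ℝ, HasDerivAt (fun s : ℝ ↦ √(s ^ 2 * ‖x‖ ^ 2 + t ^ 2))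
      (s * ‖x‖ ^ 2 / √(s ^ 2 * ‖x‖ ^ 2 + t ^ 2)) s := fun s ↦ by
    have h := (((hasDerivAt_pow 2 s).mul_const (‖x‖ ^ 2)).add_const (t ^ 2)).sqrt
      (hpos s).ne'
    refine h.congr_deriv ?_
    norm_num
    field_simp
  have hg : ∀ s : ℝ, HasDerivAt
      (fun s : ℝ ↦ (-c₁ - c₂ * ‖x‖ / t * s) / √(s ^ 2 * ‖x‖ ^ 2 + t ^ 2))
      (c₁ * s * ‖x‖ ^ 2 / √(s ^ 2 * ‖x‖ ^ 2 + t ^ 2) ^ 3 -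
        c₂ * ‖x‖ * t / √(s ^ 2 * ‖x‖ ^ 2 + t ^ 2) ^ 3) s := fun s ↦ by
    have hs := Real.sqrt_pos.2 (hpos s)
    have hsq := Real.sq_sqrt (hpos s).le
    have h := (((hasDerivAt_id s).const_mul (c₂ * ‖x‖ / t)).const_sub (-c₁)).div (hρ s) hs.ne'
    refine h.congr_deriv ?_
    simp only [id_eq, mul_one]
    set n := √(s ^ 2 * ‖x‖ ^ 2 + t ^ 2)
    field_simp
    linear_combination -(c₂ * ‖x‖) * hsq
  have h := sub_le_sub_of_deriv_le_of_mem_Icc hf hg fun s hs ↦ by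
    have hn : √(s ^ 2 * ‖x‖ ^ 2 + t ^ 2) = ‖s • x + t • ξ‖ := by
      rw [← norm_smul_add_smul_sq_of_inner_eq_zero hξ hxξ, Real.sqrt_sq (norm_nonneg _)]
    have hRn : R ≤ ‖s • x + t • ξ‖ := by
      rw [← hn]
      exact Real.le_sqrt_of_sq_le (by nlinarith [sq_nonneg (s * ‖x‖)])
    refine inner_ge_of_radial_ge_of_tangential_le hξ hxξ hs ht0 hn ?_ ?_ <;> rw [hn]
    exacts [hrad _ hRn, htan _ hRn]
  simp only [one_smul, zero_smul, zero_add, one_mul, zero_mul, mul_zero, mul_one, sub_zero,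
    one_pow, ne_eq, OfNat.ofNat_ne_zero, not_false_eq_true, zero_pow, Real.sqrt_sq ht0.le] at h
  refine le_trans (le_of_eq ?_) h
  have : 0 < √(‖x‖ ^ 2 + t ^ 2) := Real.sqrt_pos.2 (by positivity)
  field_simp
  ring

theorem setIntegral_Ioi_ge_of_radial_ge_of_tangential_le (hc : c₂ < c₁) (hc₂ : 0 < c₂)
    (hV : Differentiable ℝ V) (hR : 0 < R)
    (hdecay : ∀ x, ‖gradient V x‖ ≤ C / (1 + ‖x‖ ^ 2))
    (hrad : ∀ x : E, R ≤ ‖x‖ → ⟪‖x‖⁻¹ • x, gradient V x⟫ ≥ c₁ / ‖x‖ ^ 2)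
    (htan : ∀ x : E, R ≤ ‖x‖ →
      ‖gradient V x - ⟪‖x‖⁻¹ • x, gradient V x⟫ • (‖x‖⁻¹ • x)‖ ≤ c₂ / ‖x‖ ^ 2)
    (hξ : ‖ξ‖ = 1) (hxξ : ⟪x, ξ⟫ = 0) (hx : R ≤ ‖x‖) :
    (c₁ - c₂) * Real.log ‖x‖ - (R * (C * (Real.pi / 2)) + (c₁ - c₂) * Real.log R + c₁ + c₂) ≤
      ∫ t in Set.Ioi (0 : ℝ), (V (x + t • ξ) - V (t • ξ)) := by
  have hint := integrable_sub_of_norm_gradient_le hV hdecay hξ hxξ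
  have hlow := fun t : ℝ ↦ neg_mul_pi_div_two_le_sub hV hdecay hξ hxξ t
  have hhigh := fun (t : ℝ) (ht : R ≤ t) ↦
    sub_ge_of_radial_ge_of_tangential_le hV hR hrad htan hξ hxξ ht
  set F : ℝ → ℝ := fun t ↦ V (x + t • ξ) - V (t • ξ) with hF
  set r := ‖x‖ with hr
  have hr0 : 0 < r := hR.trans_le hx
  have hsplit : ∫ t in Set.Ioi (0 : ℝ), F t =
      (∫ t in (0 : ℝ)..R, F t) + (∫ t in R..r, F t) + ∫ t in Set.Ioi r, F t := by
    rw [intervalIntegral.integral_add_adjacent_intervals hint.intervalIntegrable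
      hint.intervalIntegrable, intervalIntegral.integral_of_le hr0.le,
      ← setIntegral_union (Set.Ioc_disjoint_Ioi le_rfl) measurableSet_Ioi hint.integrableOn
        hint.integrableOn, Set.Ioc_union_Ioi_eq_Ioi hr0.le]
  have h1 : -(R * (C * (Real.pi / 2))) ≤ ∫ t in (0 : ℝ)..R, F t := by
    have := intervalIntegral.integral_mono_on (μ := volume) hR.le
      (intervalIntegrable_const (c := -(C * (Real.pi / 2)))) hint.intervalIntegrable
      fun t _ ↦ hlow t
    rw [intervalIntegral.integral_const] at this
    simpa using this
  have h2 : (c₁ - c₂) * (Real.log r - Real.log R) - c₁ ≤ ∫ t in R..r, F t := by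
    have h0 : (0 : ℝ) ∉ Set.uIcc R r := by
      rw [Set.uIcc_of_le hx]; exact fun h ↦ absurd h.1 (not_le.2 hR)
    have hi : IntervalIntegrable (fun t : ℝ ↦ (c₁ - c₂) * t⁻¹) volume R r :=
      (intervalIntegral.intervalIntegrable_inv (fun t ht ↦ ne_of_mem_of_not_mem ht h0)
        continuousOn_id).const_mul _
    have := intervalIntegral.integral_mono_on (μ := volume) hx
      (hi.sub (intervalIntegrable_const (c := c₁ / r))) hint.intervalIntegrable fun t ht ↦ by
        have ht0 : 0 < t := hR.trans_le ht.1
        refine le_trans ?_ (hhigh t ht.1)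
        have hrρ : r ≤ √(r ^ 2 + t ^ 2) := Real.le_sqrt_of_sq_le (by nlinarith)
        have hρ0 := hr0.trans_le hrρ
        have e1 : c₁ / √(r ^ 2 + t ^ 2) ≤ c₁ / r :=
          div_le_div_of_nonneg_left (by linarith) hr0 hrρ
        have e2 : c₂ * r / (t * √(r ^ 2 + t ^ 2)) ≤ c₂ / t := by
          rw [div_le_div_iff₀ (by positivity) ht0]
          nlinarith [mul_le_mul_of_nonneg_left hrρ (mul_pos hc₂ ht0).le]
        have e3 : (c₁ - c₂) * t⁻¹ = c₁ / t - c₂ / t := by ring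
        rw [e3]
        linarith
    rw [intervalIntegral.integral_sub hi intervalIntegrable_const,
      intervalIntegral.integral_const_mul, integral_inv h0, intervalIntegral.integral_const,
      Real.log_div hr0.ne' hR.ne', smul_eq_mul] at this
    have e : (r - R) * (c₁ / r) ≤ c₁ := by
      rw [mul_div_assoc', div_le_iff₀ hr0]
      nlinarith
    linarith
  have h3 : -c₂ ≤ ∫ t in Set.Ioi r, F t := by
    have hi : IntegrableOn (fun t : ℝ ↦ -(c₂ * r) * t ^ (-2 : ℝ)) (Set.Ioi r) :=
      (integrableOn_Ioi_rpow_of_lt (by norm_num) hr0).const_mul _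
    have := setIntegral_mono_on hi hint.integrableOn measurableSet_Ioi fun t ht ↦ by
      have hrt : r < t := ht
      have ht0 : 0 < t := hr0.trans hrt
      refine le_trans ?_ (hhigh t (hx.trans hrt.le))
      have htρ : t ≤ √(r ^ 2 + t ^ 2) := Real.le_sqrt_of_sq_le (by nlinarith)
      have e1 : c₁ / √(r ^ 2 + t ^ 2) ≤ c₁ / t :=
        div_le_div_of_nonneg_left (by linarith) ht0 htρ
      have e2 : c₂ * r / (t * √(r ^ 2 + t ^ 2)) ≤ c₂ * r / (t * t) := by
        gcongr
      have e3 : -(c₂ * r) * t ^ (-2 : ℝ) = -(c₂ * r / (t * t)) := by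
        rw [Real.rpow_neg ht0.le, Real.rpow_two]
        field_simp
      rw [e3]
      linarith
    rw [integral_const_mul, integral_Ioi_rpow_of_lt (by norm_num) hr0] at this
    refine le_trans (le_of_eq ?_) this
    norm_num
    rw [Real.rpow_neg_one]
    field_simp
  rw [hsplit]
  linarith

end Line

theorem stmt_8 {d : ℕ} (V : EuclideanSpace ℝ (Fin d) → ℝ) (C c₁ c₂ R : ℝ)
    (hc : c₁ > c₂) (hc₂ : 0 < c₂) (hR : 0 < R)
    (hV : ContDiff ℝ 1 V)
    (hdecay : ∀ x, ‖gradient V x‖ ≤ C / (1 + ‖x‖ ^ 2))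
    (hrad : ∀ x : EuclideanSpace ℝ (Fin d), R ≤ ‖x‖ →
      ⟪‖x‖⁻¹ • x, gradient V x⟫ ≥ c₁ / ‖x‖ ^ 2)
    (htan : ∀ x : EuclideanSpace ℝ (Fin d), R ≤ ‖x‖ →
      ‖gradient V x - ⟪‖x‖⁻¹ • x, gradient V x⟫ • (‖x‖⁻¹ • x)‖ ≤ c₂ / ‖x‖ ^ 2) :
    ∃ c₃ > 0, ∀ ξ x : EuclideanSpace ℝ (Fin d), ‖ξ‖ = 1 → ⟪x, ξ⟫ = 0 → R ≤ ‖x‖ →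
      (∫ t : ℝ, (V (x + t • ξ) - V (t • ξ)))
        ≥ 2 * (c₁ - c₂) * Real.log ‖x‖ - c₃ := by
  have hV' : Differentiable ℝ V := hV.differentiable (by norm_num)
  set K := R * (C * (Real.pi / 2)) + (c₁ - c₂) * Real.log R + c₁ + c₂ with hK
  refine ⟨2 * |K| + 1, by positivity, fun ξ x hξ hxξ hx ↦ ?_⟩
  have h1 := setIntegral_Ioi_ge_of_radial_ge_of_tangential_le hc hc₂ hV' hR hdecay hrad htan
    hξ hxξ hx
  have h2 := setIntegral_Ioi_ge_of_radial_ge_of_tangential_le (ξ := -ξ) hc hc₂ hV' hR hdecay hrad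
    htan (by rwa [norm_neg]) (by rw [inner_neg_right, hxξ, neg_zero]) hx
  have hint := integrable_sub_of_norm_gradient_le hV' hdecay hξ hxξ
  have hneg : ∫ t in Set.Ioi (0 : ℝ), (V (x + t • -ξ) - V (t • -ξ)) =
      ∫ t in Set.Iic (0 : ℝ), (V (x + t • ξ) - V (t • ξ)) := by
    have := integral_comp_neg_Ioi (0 : ℝ) fun t ↦ V (x + t • ξ) - V (t • ξ)
    simpa only [neg_zero, neg_smul, smul_neg] using this
  rw [hneg] at h2
  rw [← intervalIntegral.integral_Iic_add_Ioi hint.integrableOn hint.integrableOn (b := 0)]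
  linarith [le_abs_self K]
end

section
/- Let U₁, U₂ be unitary operators on a separable Hilbert space such that U₁ − U₂ is trace class. Then the absolutely continuous spectra coincide: σ_ac(U₁) = σ_ac(U₂). -/
open MeasureTheory
open scoped ComplexInnerProductSpace

variable {H : Type*} [NormedAddCommGroup H] [InnerProductSpace ℂ H] [CompleteSpace H]

/-- A bounded operator is trace class if it admits a nuclear (trace-class) representation
as an absolutely summable series of rank-one operators with normalized vectors. -/
def IsTraceClass (T : H →L[ℂ] H) : Prop :=
  ∃ (c : ℕ → ℂ) (u v : ℕ → H), (∀ i, ‖u i‖ ≤ 1) ∧ (∀ i, ‖v i‖ ≤ 1) ∧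
    Summable (fun i => ‖c i‖) ∧ ∀ x, T x = ∑' i, c i • (⟪v i, x⟫ • u i)

/-- `x` is an absolutely continuous vector for the unitary `U` if its scalar spectral
measure (a finite measure on the circle parametrized by `θ ∈ ℝ`, determined by its
Fourier coefficients `⟪x, U^n x⟫`) is absolutely continuous w.r.t. Lebesgue measure. -/
def IsAcVector (U : H →L[ℂ] H) (x : H) : Prop :=
  ∃ μ : Measure ℝ, IsFiniteMeasure μ ∧ μ ≪ volume ∧ μ (Set.Ico 0 (2 * Real.pi))ᶜ = 0 ∧
    ∀ n : ℕ, (∫ θ : ℝ, Complex.exp (Complex.I * n * θ) ∂μ = ⟪x, (U ^ n) x⟫) ∧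
      (∫ θ : ℝ, Complex.exp (-(Complex.I * n * θ)) ∂μ
        = ⟪x, ((ContinuousLinearMap.adjoint U) ^ n) x⟫)

/-- The absolutely continuous spectrum of a unitary operator: the approximate point
spectrum of its restriction to the absolutely continuous subspace. -/
def acSpectrum (U : H →L[ℂ] H) : Set ℂ :=
  {z : ℂ | ∀ ε > 0, ∃ x : H, IsAcVector U x ∧ x ≠ 0 ∧ ‖U x - z • x‖ < ε * ‖x‖}

set_option linter.unusedSectionVars false

open Filter Topology
open scoped ENNReal

/-- The representation of `ℤ` by the powers of a unitary operator. -/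
noncomputable def zpowOperatorHom (e : H ≃ₗᵢ[ℂ] H) : Multiplicative ℤ →* (H →L[ℂ] H) where
  toFun n := ((e ^ n.toAdd : H ≃ₗᵢ[ℂ] H) : H →L[ℂ] H)
  map_one' := by ext; simp
  map_mul' m n := by ext; simp [zpow_add]

/-- The representation of `ℤ` by the Fourier monomials. -/
noncomputable def fourierHom (T : ℝ) : Multiplicative ℤ →* C(AddCircle T, ℂ) where
  toFun n := fourier n.toAdd
  map_one' := by ext; simp
  map_mul' m n := by ext; simp

/-- Evaluation of a Laurent polynomial at a unitary operator. -/
noncomputable def operatorEval (e : H ≃ₗᵢ[ℂ] H) : AddMonoidAlgebra ℂ ℤ →ₐ[ℂ] (H →L[ℂ] H) :=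
  AddMonoidAlgebra.lift ℂ (H →L[ℂ] H) ℤ (zpowOperatorHom e)

/-- Evaluation of a Laurent polynomial on the circle. -/
noncomputable def circleEval (T : ℝ) : AddMonoidAlgebra ℂ ℤ →ₐ[ℂ] C(AddCircle T, ℂ) :=
  AddMonoidAlgebra.lift ℂ C(AddCircle T, ℂ) ℤ (fourierHom T)

lemma operatorEval_single (e : H ≃ₗᵢ[ℂ] H) (n : ℤ) (a : ℂ) (x : H) :
    operatorEval e (.single n a) x = a • (e ^ n) x := by
  rw [operatorEval, AddMonoidAlgebra.lift_single]
  rfl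

lemma circleEval_single (T : ℝ) (n : ℤ) (a : ℂ) :
    circleEval T (.single n a) = a • fourier n := by
  rw [circleEval, AddMonoidAlgebra.lift_single]
  rfl

lemma inner_zpow_zpow (e : H ≃ₗᵢ[ℂ] H) (m n : ℤ) (x y : H) :
    ⟪(e ^ m) x, (e ^ n) y⟫ = ⟪x, (e ^ (n - m)) y⟫ := by
  rw [← (e ^ m).inner_map_map x, show (e ^ m) ((e ^ (n - m)) y) = (e ^ m * e ^ (n - m)) y from rfl,
    ← zpow_add, add_sub_cancel]

section Spectral

variable {T : ℝ} [hT : Fact (0 < T)]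

lemma inner_operatorEval {e : H ≃ₗᵢ[ℂ] H} {x : H} {ν : Measure (AddCircle T)} [IsFiniteMeasure ν]
    (hν : ∀ n : ℤ, ∫ t, fourier n t ∂ν = ⟪x, (e ^ n) x⟫) (p q : AddMonoidAlgebra ℂ ℤ) :
    ⟪operatorEval e p x, operatorEval e q x⟫ =
      ⟪ContinuousMap.toLp 2 ν ℂ (circleEval T p), ContinuousMap.toLp 2 ν ℂ (circleEval T q)⟫ := by
  induction p using AddMonoidAlgebra.induction_linear with
  | zero => simp
  | add p₁ p₂ h₁ h₂ => simp only [map_add, add_apply, inner_add_left, h₁, h₂]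
  | single m a =>
    induction q using AddMonoidAlgebra.induction_linear with
    | zero => simp
    | add p₁ p₂ h₁ h₂ =>
      simp only [map_add, add_apply, inner_add_right, h₁, h₂]
    | single n b =>
      rw [operatorEval_single, operatorEval_single, circleEval_single, circleEval_single,
        map_smul, map_smul, inner_smul_left, inner_smul_left, inner_smul_right, inner_smul_right,
        inner_zpow_zpow, ← hν, ContinuousMap.inner_toLp]
      congr 3 with t
      rw [← fourier_neg, ← fourier_add, sub_eq_add_neg]

lemma norm_operatorEval {e : H ≃ₗᵢ[ℂ] H} {x : H} {ν : Measure (AddCircle T)} [IsFiniteMeasure ν]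
    (hν : ∀ n : ℤ, ∫ t, fourier n t ∂ν = ⟪x, (e ^ n) x⟫) (p : AddMonoidAlgebra ℂ ℤ) :
    ‖operatorEval e p x‖ = ‖ContinuousMap.toLp 2 ν ℂ (circleEval T p)‖ := by
  rw [← sq_eq_sq₀ (norm_nonneg _) (norm_nonneg _)]
  have h := inner_operatorEval hν p p
  rw [inner_self_eq_norm_sq_to_K, inner_self_eq_norm_sq_to_K] at h
  exact_mod_cast h

lemma denseRange_circleEval (ν : Measure (AddCircle T)) [IsFiniteMeasure ν] :
    DenseRange fun p ↦ ContinuousMap.toLp (E := ℂ) 2 ν ℂ (circleEval T p) := by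
  refine (ContinuousMap.toLp_denseRange ℂ ν ℂ (p := 2) (by simp)).comp (f := circleEval T) ?_
    (ContinuousLinearMap.continuous _)
  have h := span_fourier_closure_eq_top (T := T)
  replace h := Submodule.dense_iff_topologicalClosure_eq_top.mpr h
  refine Dense.mono ?_ h
  suffices Submodule.span ℂ (Set.range (fourier (T := T))) ≤
      LinearMap.range (circleEval T).toLinearMap from this
  rw [Submodule.span_le]
  rintro _ ⟨n, rfl⟩
  exact ⟨.single n 1, (circleEval_single T n 1).trans (one_smul _ _)⟩

lemma eLpNorm_circleEval_haar (N : ℕ) (a : ℕ → ℂ) :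
    eLpNorm (circleEval T (∑ k ∈ Finset.range N, .single (k : ℤ) (a k))) 2
      AddCircle.haarAddCircle = ENNReal.ofReal (√(∑ k ∈ Finset.range N, ‖a k‖ ^ 2)) := by
  have h : ContinuousMap.toLp (E := ℂ) 2 AddCircle.haarAddCircle ℂ
      (circleEval T (∑ k ∈ Finset.range N, .single (k : ℤ) (a k))) =
      ∑ k ∈ Finset.range N, a k • fourierLp (T := T) 2 (k : ℤ) := by
    simp only [map_sum, circleEval_single, map_smul]
  have hn := congrArg enorm h
  rw [Lp.enorm_def, eLpNorm_congr_ae (ContinuousMap.coeFn_toLp _ _)] at hn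
  rw [hn, ← ofReal_norm]
  congr 1
  refine (Real.sqrt_eq_iff_eq_sq (by positivity) (norm_nonneg _)).mpr ?_ |>.symm
  have ho : Orthonormal ℂ (fun k : ℕ ↦ fourierLp (T := T) 2 (k : ℤ)) :=
    orthonormal_fourier.comp _ Nat.cast_injective
  have := ho.inner_sum a a (Finset.range N)
  rw [inner_self_eq_norm_sq_to_K] at this
  have h2 : ∀ k, (starRingEnd ℂ) (a k) * a k = ((‖a k‖ ^ 2 : ℝ) : ℂ) := fun k ↦ by
    rw [mul_comm, Complex.mul_conj, Complex.normSq_eq_norm_sq]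
  simp only [h2] at this
  exact Complex.ofReal_injective (by simpa using this.symm)

/-- Extension of `φ ↦ φ(e) x` from Laurent polynomials to `L²` of the spectral measure. -/
lemma exists_functionalCalculus {e : H ≃ₗᵢ[ℂ] H} {x : H} {ν : Measure (AddCircle T)}
    [IsFiniteMeasure ν] (hν : ∀ n : ℤ, ∫ t, fourier n t ∂ν = ⟪x, (e ^ n) x⟫) :
    ∃ V : Lp ℂ 2 ν →L[ℂ] H, V (ContinuousMap.toLp 2 ν ℂ 1) = x ∧
      ∀ q φ, ‖operatorEval e q (V φ)‖ₑ = eLpNorm (fun t ↦ circleEval T q t * φ t) 2 ν := by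
  let E : AddMonoidAlgebra ℂ ℤ →ₗ[ℂ] Lp ℂ 2 ν :=
    (ContinuousMap.toLp 2 ν ℂ).toLinearMap ∘ₗ (circleEval T).toLinearMap
  let F : AddMonoidAlgebra ℂ ℤ →ₗ[ℂ] H :=
    (ContinuousLinearMap.apply ℂ H x).toLinearMap ∘ₗ (operatorEval e).toLinearMap
  have hE : DenseRange E := denseRange_circleEval ν
  have hn : ∃ C, ∀ p, ‖F p‖ ≤ C * ‖E p‖ := ⟨1, fun p ↦ by
    rw [one_mul]; exact (norm_operatorEval hν p).le⟩
  have hV : ∀ p, F.extendOfNorm E (ContinuousMap.toLp 2 ν ℂ (circleEval T p)) =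
      operatorEval e p x := LinearMap.extendOfNorm_eq hE hn
  refine ⟨F.extendOfNorm E, ?_, fun q φ ↦ ?_⟩
  · simpa using hV 1
  · let M : Lp ℂ 2 ν →L[ℂ] Lp ℂ 2 ν := (ContinuousLinearMap.mul ℂ ℂ).holderL ν ∞ 2 2
      (ContinuousMap.toLp ∞ ν ℂ (circleEval T q))
    have hM : ∀ φ, M φ =ᵐ[ν] fun t ↦ circleEval T q t * φ t := fun φ ↦ by
      filter_upwards [(ContinuousLinearMap.mul ℂ ℂ).coeFn_holder (r := 2)
        (ContinuousMap.toLp ∞ ν ℂ (circleEval T q)) φ,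
        ContinuousMap.coeFn_toLp (p := ∞) (𝕜 := ℂ) ν (circleEval T q)] with t h₁ h₂
      rw [← h₂]
      exact h₁
    rw [← eLpNorm_congr_ae (hM φ), ← Lp.enorm_def]
    refine hE.induction_on (p := fun φ ↦ ‖operatorEval e q (F.extendOfNorm E φ)‖ₑ = ‖M φ‖ₑ) φ
      (isClosed_eq (by fun_prop) (by fun_prop)) fun p ↦ ?_
    have h₁ : operatorEval e q (F.extendOfNorm E (E p)) = operatorEval e (q * p) x := by
      rw [map_mul]
      exact congrArg _ (hV p)
    have h₂ : M (E p) = ContinuousMap.toLp 2 ν ℂ (circleEval T (q * p)) := by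
      refine Lp.ext ?_
      filter_upwards [hM (E p), ContinuousMap.coeFn_toLp (p := 2) (𝕜 := ℂ) ν (circleEval T p),
        ContinuousMap.coeFn_toLp (p := 2) (𝕜 := ℂ) ν (circleEval T (q * p))] with t h₁ h₂ h₃
      rw [h₁, h₃, map_mul, ContinuousMap.mul_apply, ← h₂]
      rfl
    rw [h₁, h₂, ← ofReal_norm, ← ofReal_norm, norm_operatorEval hν]

lemma exists_bounded_density_vector {e : H ≃ₗᵢ[ℂ] H} {x : H} {ν : Measure (AddCircle T)}
    [IsFiniteMeasure ν] (hν : ∀ n : ℤ, ∫ t, fourier n t ∂ν = ⟪x, (e ^ n) x⟫)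
    (hac : ν ≪ AddCircle.haarAddCircle) {ε : ℝ} (hε : 0 < ε) :
    ∃ y, ‖x - y‖ < ε ∧ ∃ C : ℝ, 0 ≤ C ∧ ∀ (N : ℕ) (a : ℕ → ℂ),
      ‖∑ k ∈ Finset.range N, a k • (e ^ k) y‖ ≤ C * √(∑ k ∈ Finset.range N, ‖a k‖ ^ 2) := by
  obtain ⟨V, hV1, hV⟩ := exists_functionalCalculus hν
  let h := ν.rnDeriv AddCircle.haarAddCircle
  have hh : Measurable h := Measure.measurable_rnDeriv _ _
  let S : ℕ → Set (AddCircle T) := fun M ↦ {t | h t ≤ M}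
  have hS : ∀ M, MeasurableSet (S M) := fun M ↦ measurableSet_le hh measurable_const
  have hlim : Tendsto (fun M ↦ ν (symmDiff (S M) Set.univ)) atTop (𝓝 0) := by
    have h0 : ν (⋂ M, (S M)ᶜ) = 0 := by
      refine measure_mono_null (t := {t | ¬ h t < ∞}) (fun t ht hlt ↦ ?_)
        (hac (Measure.rnDeriv_lt_top ν AddCircle.haarAddCircle))
      obtain ⟨n, hn⟩ := ENNReal.exists_nat_gt hlt.ne
      exact Set.mem_iInter.mp ht n hn.le
    rw [← h0]
    have : ∀ M, symmDiff (S M) Set.univ = (S M)ᶜ := fun M ↦ by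
      rw [← Set.top_eq_univ, symmDiff_top, hnot_eq_compl]
    simp only [this]
    refine tendsto_measure_iInter_atTop (fun M ↦ (hS M).compl.nullMeasurableSet)
      (fun m n hmn ↦ Set.compl_subset_compl.mpr fun t ht ↦ ?_) ⟨0, measure_ne_top _ _⟩
    exact le_trans (show h t ≤ m from ht) (by exact_mod_cast hmn)
  have hlim2 := tendsto_indicatorConstLp_set (p := 2) (c := (1 : ℂ)) (hs := MeasurableSet.univ)
    (hμs := measure_ne_top ν _) (ht := hS) (hμt := fun _ ↦ measure_ne_top ν _) (by simp) hlim
  have h1 : indicatorConstLp 2 MeasurableSet.univ (measure_ne_top ν _) (1 : ℂ) =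
      ContinuousMap.toLp 2 ν ℂ 1 := by
    refine Lp.ext ?_
    filter_upwards [indicatorConstLp_coeFn (p := 2) (hs := MeasurableSet.univ)
      (hμs := measure_ne_top ν _) (c := (1 : ℂ)),
      ContinuousMap.coeFn_toLp (p := 2) (𝕜 := ℂ) ν (1 : C(AddCircle T, ℂ))] with t h₁ h₂
    rw [h₁, h₂]
    simp
  have hlim3 := (V.continuous.tendsto _).comp hlim2
  rw [h1, hV1] at hlim3
  obtain ⟨M, hM⟩ := (Metric.tendsto_atTop.mp hlim3 ε hε)
  refine ⟨_, by simpa [dist_eq_norm, norm_sub_rev] using hM M le_rfl, √M, by positivity,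
    fun N a ↦ ?_⟩
  set y := V (indicatorConstLp 2 (hS M) (measure_ne_top ν _) (1 : ℂ)) with hy
  set q : AddMonoidAlgebra ℂ ℤ := ∑ k ∈ Finset.range N, .single (k : ℤ) (a k) with hq
  have hsum : ∑ k ∈ Finset.range N, a k • (e ^ k) y = operatorEval e q y := by
    simp only [hq, map_sum, sum_apply, operatorEval_single, zpow_natCast]
  have hle : ν.restrict (S M) ≤ (M : ℝ≥0∞) • AddCircle.haarAddCircle := by
    rw [← Measure.withDensity_rnDeriv_eq ν _ hac, restrict_withDensity (hS M),
      ← withDensity_const, ← withDensity_indicator (hS M)]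
    refine withDensity_mono (ae_of_all _ fun t ↦ ?_)
    exact Set.indicator_le (fun t ht ↦ ht) t
  rw [hsum, ← ENNReal.ofReal_le_ofReal_iff (by positivity), ofReal_norm, hV,
    ENNReal.ofReal_mul (by positivity), ← eLpNorm_circleEval_haar (T := T), ← hq]
  calc eLpNorm (fun t ↦ circleEval T q t *
        indicatorConstLp 2 (hS M) (measure_ne_top ν _) (1 : ℂ) t) 2 ν
      = eLpNorm ((S M).indicator (circleEval T q)) 2 ν := by
        refine eLpNorm_congr_ae ?_
        filter_upwards [indicatorConstLp_coeFn (p := 2) (hs := hS M)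
          (hμs := measure_ne_top ν _) (c := (1 : ℂ))] with t ht
        rw [ht]
        by_cases hm : t ∈ S M <;> simp [hm]
    _ = eLpNorm (circleEval T q) 2 (ν.restrict (S M)) := eLpNorm_indicator_eq_eLpNorm_restrict (hS M)
    _ ≤ eLpNorm (circleEval T q) 2 ((M : ℝ≥0∞) • AddCircle.haarAddCircle) :=
        eLpNorm_mono_measure _ hle
    _ ≤ _ := by
        rw [eLpNorm_smul_measure_of_ne_top (by simp), smul_eq_mul, Real.sqrt_eq_rpow,
          ← ENNReal.ofReal_rpow_of_nonneg (by positivity) (by positivity), ENNReal.ofReal_natCast]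
        simp

end Spectral

lemma coe_pow_apply (e : H ≃ₗᵢ[ℂ] H) (k : ℕ) (y : H) :
    ((e : H →L[ℂ] H) ^ k) y = (e ^ k) y := by
  induction k generalizing y with
  | zero => rfl
  | succ k ih => rw [pow_succ, pow_succ]; exact ih _

lemma exists_spectralMeasure_addCircle [Fact (0 < 2 * Real.pi)] {e : H ≃ₗᵢ[ℂ] H} {x : H}
    (hx : IsAcVector (e : H →L[ℂ] H) x) :
    ∃ ν : Measure (AddCircle (2 * Real.pi)), IsFiniteMeasure ν ∧ ν ≪ AddCircle.haarAddCircle ∧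
      ∀ n : ℤ, ∫ t, fourier n t ∂ν = ⟪x, (e ^ n) x⟫ := by
  obtain ⟨μ, hfin, hac, hsupp, hμ⟩ := hx
  have hm : Measurable ((↑) : ℝ → AddCircle (2 * Real.pi)) := AddCircle.measurable_mk'
  refine ⟨μ.map (↑), inferInstance, ?_, fun n ↦ ?_⟩
  · refine (Measure.AbsolutelyContinuous.mk fun A hA h0 ↦ ?_ :
      μ.map ((↑) : ℝ → AddCircle (2 * Real.pi)) ≪ volume).trans ?_
    · rw [Measure.map_apply hm hA]
      rw [← (AddCircle.measurePreserving_mk (2 * Real.pi) 0).measure_preimage hA.nullMeasurableSet,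
        Measure.restrict_apply (hm hA), zero_add] at h0
      refine measure_mono_null (t := (((↑) : ℝ → AddCircle (2 * Real.pi)) ⁻¹' A ∩
        Set.Ioc 0 (2 * Real.pi)) ∪ ({0} ∪ (Set.Ico 0 (2 * Real.pi))ᶜ)) (fun t ht ↦ ?_) ?_
      · by_cases h1 : t ∈ Set.Ico 0 (2 * Real.pi)
        · rcases h1.1.eq_or_lt with h2 | h2
          · exact .inr (.inl h2.symm)
          · exact .inl ⟨ht, h2, h1.2.le⟩
        · exact .inr (.inr h1)
      · exact measure_union_null (hac h0) (measure_union_null (hac (by simp)) hsupp)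
    · rw [AddCircle.volume_eq_smul_haarAddCircle]
      exact Measure.smul_absolutelyContinuous
  · rw [integral_map hm.aemeasurable (fourier n).continuous.aestronglyMeasurable]
    have hf : ∀ t : ℝ, fourier n (t : AddCircle (2 * Real.pi)) =
        Complex.exp (Complex.I * n * t) := fun t ↦ by
      rw [fourier_coe_apply]
      congr 1
      push_cast
      field_simp
    simp only [hf]
    obtain ⟨k, rfl | rfl⟩ := n.eq_nat_or_neg
    · rw [zpow_natCast, ← coe_pow_apply]
      simpa using (hμ k).1
    · rw [zpow_neg, zpow_natCast, ← inv_pow, ← coe_pow_apply,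
        show ((e⁻¹ : H ≃ₗᵢ[ℂ] H) : H →L[ℂ] H) = e.symm from rfl,
        ← LinearIsometryEquiv.adjoint_eq_symm]
      simpa using (hμ k).2

/-- A sequence of vectors satisfying the Bessel inequality with constant `C ^ 2`. -/
def IsBesselSeq (y : ℕ → H) (C : ℝ) : Prop :=
  ∀ (v : H) (N : ℕ), ∑ k ∈ Finset.range N, ‖⟪v, y k⟫‖ ^ 2 ≤ C ^ 2 * ‖v‖ ^ 2

lemma isBesselSeq_of_norm_sum_le {y : ℕ → H} {C : ℝ} (h : ∀ (N : ℕ) (a : ℕ → ℂ),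
      ‖∑ k ∈ Finset.range N, a k • y k‖ ≤ C * √(∑ k ∈ Finset.range N, ‖a k‖ ^ 2)) :
    IsBesselSeq y C := by
  intro v N
  set s := ∑ k ∈ Finset.range N, ‖⟪v, y k⟫‖ ^ 2 with hs
  have hs0 : 0 ≤ s := by positivity
  have h1 := h N (fun k ↦ ⟪y k, v⟫)
  have h2 : ⟪v, ∑ k ∈ Finset.range N, ⟪y k, v⟫ • y k⟫ = (s : ℂ) := by
    simp only [inner_sum, inner_smul_right, hs]
    push_cast
    refine Finset.sum_congr rfl fun k _ ↦ ?_
    rw [← inner_conj_symm (y k) v, mul_comm, Complex.mul_conj, Complex.normSq_eq_norm_sq]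
    norm_cast
  have h3 : s ≤ ‖v‖ * (C * √s) := by
    calc s = ‖(s : ℂ)‖ := by simp [abs_of_nonneg hs0]
      _ ≤ ‖v‖ * ‖∑ k ∈ Finset.range N, ⟪y k, v⟫ • y k‖ := by rw [← h2]; exact norm_inner_le_norm _ _
      _ ≤ _ := by
        gcongr
        simpa only [norm_inner_symm (𝕜 := ℂ) _ v] using h1
  rcases hs0.eq_or_lt with h0 | h0
  · rw [← h0]; positivity
  · have h4 : 0 < √s := Real.sqrt_pos.mpr h0
    have h5 : √s ≤ ‖v‖ * C := by
      have : √s * √s ≤ (‖v‖ * C) * √s := by rw [Real.mul_self_sqrt hs0]; linarith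
      exact le_of_mul_le_mul_right this h4
    calc s = √s ^ 2 := (Real.sq_sqrt hs0).symm
      _ ≤ (‖v‖ * C) ^ 2 := by gcongr
      _ = _ := by ring

lemma exists_isBesselSeq_near {e : H ≃ₗᵢ[ℂ] H} {x : H} (hx : IsAcVector (e : H →L[ℂ] H) x)
    {ε : ℝ} (hε : 0 < ε) :
    ∃ y, ‖x - y‖ < ε ∧ ∃ C : ℝ, 0 ≤ C ∧ IsBesselSeq (fun k ↦ (e ^ k) y) C := by
  have : Fact (0 < 2 * Real.pi) := ⟨Real.two_pi_pos⟩
  obtain ⟨ν, hfin, hac, hν⟩ := exists_spectralMeasure_addCircle hx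
  obtain ⟨y, hy, C, hC, h⟩ := exists_bounded_density_vector hν hac hε
  exact ⟨y, hy, C, hC, isBesselSeq_of_norm_sum_le h⟩

lemma IsBesselSeq.shift {y : ℕ → H} {C : ℝ} (h : IsBesselSeq y C) (m : ℕ) :
    IsBesselSeq (fun k ↦ y (k + m)) C := by
  intro v N
  refine le_trans ?_ (h v (N + m))
  rw [add_comm N m, Finset.sum_range_add]
  simp only [add_comm m]
  exact le_add_of_nonneg_left (by positivity)

lemma IsBesselSeq.map {y : ℕ → H} {C : ℝ} (h : IsBesselSeq y C) (g : H ≃ₗᵢ[ℂ] H) :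
    IsBesselSeq (fun k ↦ g (y k)) C := by
  intro v N
  have := h (g⁻¹ v) N
  have hg : ∀ k, ⟪v, g (y k)⟫ = ⟪g⁻¹ v, y k⟫ := fun k ↦ by
    rw [← g.inner_map_map (g⁻¹ v), show g (g⁻¹ v) = v from g.apply_symm_apply v]
  simpa [hg] using this

lemma IsBesselSeq.summable {y : ℕ → H} {C : ℝ} (h : IsBesselSeq y C) (v : H) :
    Summable fun k ↦ ‖⟪v, y k⟫‖ ^ 2 :=
  summable_of_sum_range_le (fun _ ↦ by positivity) (h v)

lemma IsBesselSeq.sqrt_tsum_le {y : ℕ → H} {C : ℝ} (h : IsBesselSeq y C) (hC : 0 ≤ C) {v : H}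
    (hv : ‖v‖ ≤ 1) : √(∑' k, ‖⟪v, y k⟫‖ ^ 2) ≤ C := by
  rw [Real.sqrt_le_left hC]
  refine (Real.tsum_le_of_sum_range_le (fun _ ↦ by positivity) (h v)).trans ?_
  exact mul_le_of_le_one_right (by positivity) (pow_le_one₀ (norm_nonneg _) hv)

section TraceClass

variable {c : ℕ → ℂ} {u v : ℕ → H}

/-- The tail of a Bessel sequence, weighted by the coefficients of a trace class operator. -/
noncomputable def weightedTail (c : ℕ → ℂ) (v : ℕ → H) (z : ℕ → H) (m : ℕ) : ℝ :=
  ∑' i, ‖c i‖ * √(∑' k, ‖⟪v i, z (k + m)⟫‖ ^ 2)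

lemma tendsto_weightedTail (hv : ∀ i, ‖v i‖ ≤ 1) (hc : Summable fun i ↦ ‖c i‖) {z : ℕ → H}
    {C : ℝ} (hC : 0 ≤ C) (hz : IsBesselSeq z C) :
    Tendsto (weightedTail c v z) atTop (𝓝 0) := by
  have h0 : ∀ i, Tendsto (fun m ↦ ‖c i‖ * √(∑' k, ‖⟪v i, z (k + m)⟫‖ ^ 2)) atTop (𝓝 0) := by
    intro i
    have h1 := tendsto_sum_nat_add fun k ↦ ‖⟪v i, z k⟫‖ ^ 2
    simpa using (h1.sqrt).const_mul ‖c i‖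
  have := tendsto_tsum_of_dominated_convergence (𝓕 := atTop) (bound := fun i ↦ ‖c i‖ * C)
    (hc.mul_right C) h0 (Eventually.of_forall fun m i ↦ by
      rw [norm_mul, norm_norm, Real.norm_of_nonneg (Real.sqrt_nonneg _)]
      gcongr
      exact (hz.shift m).sqrt_tsum_le hC (hv i))
  rwa [tsum_zero] at this

lemma norm_inner_nuclear_le (hu : ∀ i, ‖u i‖ ≤ 1) (hv : ∀ i, ‖v i‖ ≤ 1)
    (hc : Summable fun i ↦ ‖c i‖) {T : H →L[ℂ] H}
    (hT : ∀ x, T x = ∑' i, c i • (⟪v i, x⟫ • u i)) (y z : H) :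
    Summable (fun i ↦ ‖c i‖ * (‖⟪v i, z⟫‖ * ‖⟪u i, y⟫‖)) ∧
      ‖⟪y, T z⟫‖ ≤ ∑' i, ‖c i‖ * (‖⟪v i, z⟫‖ * ‖⟪u i, y⟫‖) := by
  have hb : ∀ (w x : H), ‖w‖ ≤ 1 → ‖⟪w, x⟫‖ ≤ ‖x‖ := fun w x hw ↦
    (norm_inner_le_norm w x).trans (mul_le_of_le_one_left (norm_nonneg _) hw)
  have hs1 : Summable fun i ↦ c i • (⟪v i, z⟫ • u i) := by
    refine Summable.of_norm_bounded (hc.mul_right ‖z‖) fun i ↦ ?_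
    rw [norm_smul, norm_smul]
    gcongr
    exact (mul_le_of_le_one_right (norm_nonneg _) (hu i)).trans (hb _ _ (hv i))
  have hs2 : Summable (fun i ↦ ‖c i‖ * (‖⟪v i, z⟫‖ * ‖⟪u i, y⟫‖)) := by
    refine Summable.of_nonneg_of_le (fun _ ↦ by positivity) (fun i ↦ ?_)
      (hc.mul_right (‖z‖ * ‖y‖))
    gcongr
    exacts [hb _ _ (hv i), hb _ _ (hu i)]
  have he : ∀ i, ‖innerSL ℂ y (c i • (⟪v i, z⟫ • u i))‖ =
      ‖c i‖ * (‖⟪v i, z⟫‖ * ‖⟪u i, y⟫‖) := fun i ↦ by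
    rw [innerSL_apply_apply, inner_smul_right, inner_smul_right, norm_mul, norm_mul,
      norm_inner_symm y]
  refine ⟨hs2, ?_⟩
  rw [hT, ← innerSL_apply_apply ℂ, (innerSL ℂ y).map_tsum hs1, ← tsum_congr he]
  exact norm_tsum_le_tsum_norm (by simpa only [he] using hs2)

lemma sum_norm_inner_nuclear_le (hu : ∀ i, ‖u i‖ ≤ 1) (hv : ∀ i, ‖v i‖ ≤ 1)
    (hc : Summable fun i ↦ ‖c i‖) {T : H →L[ℂ] H}
    (hT : ∀ x, T x = ∑' i, c i • (⟪v i, x⟫ • u i)) {y z : ℕ → H} {C D : ℝ} (hC : 0 ≤ C)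
    (hz : IsBesselSeq z C) (hD : 0 ≤ D) (hy : IsBesselSeq y D) (m K : ℕ) :
    ∑ k ∈ Finset.range K, ‖⟪y k, T (z (k + m))⟫‖ ≤ D * weightedTail c v z m := by
  have hs : Summable fun i ↦ ‖c i‖ * √(∑' k, ‖⟪v i, z (k + m)⟫‖ ^ 2) := by
    refine Summable.of_nonneg_of_le (fun _ ↦ by positivity) (fun i ↦ ?_) (hc.mul_right C)
    gcongr
    exact (hz.shift m).sqrt_tsum_le hC (hv i)
  calc ∑ k ∈ Finset.range K, ‖⟪y k, T (z (k + m))⟫‖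
      ≤ ∑ k ∈ Finset.range K, ∑' i, ‖c i‖ * (‖⟪v i, z (k + m)⟫‖ * ‖⟪u i, y k⟫‖) :=
        Finset.sum_le_sum fun k _ ↦ (norm_inner_nuclear_le hu hv hc hT _ _).2
    _ = ∑' i, ∑ k ∈ Finset.range K, ‖c i‖ * (‖⟪v i, z (k + m)⟫‖ * ‖⟪u i, y k⟫‖) :=
        (Summable.tsum_finsetSum fun k _ ↦ (norm_inner_nuclear_le hu hv hc hT _ _).1).symm
    _ ≤ ∑' i, D * (‖c i‖ * √(∑' k, ‖⟪v i, z (k + m)⟫‖ ^ 2)) := by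
        refine Summable.tsum_le_tsum (fun i ↦ ?_)
          (summable_sum fun k _ ↦ (norm_inner_nuclear_le hu hv hc hT _ _).1) (hs.mul_left D)
        rw [← Finset.mul_sum, mul_left_comm]
        gcongr
        refine (Real.sum_mul_le_sqrt_mul_sqrt _ _ _).trans ?_
        rw [mul_comm]
        gcongr
        · refine le_trans (Real.sqrt_le_sqrt ?_) (hy.sqrt_tsum_le hD (hu i))
          exact (hy.summable (u i)).sum_le_tsum _ fun _ _ ↦ by positivity
        · exact ((hz.shift m).summable (v i)).sum_le_tsum _ fun _ _ ↦ by positivity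
    _ = D * weightedTail c v z m := tsum_mul_left

lemma tendsto_nuclear_apply (hu : ∀ i, ‖u i‖ ≤ 1) (hv : ∀ i, ‖v i‖ ≤ 1)
    (hc : Summable fun i ↦ ‖c i‖) {T : H →L[ℂ] H}
    (hT : ∀ x, T x = ∑' i, c i • (⟪v i, x⟫ • u i)) {z : ℕ → H} {C : ℝ} (hC : 0 ≤ C)
    (hz : IsBesselSeq z C) : Tendsto (fun k ↦ T (z k)) atTop (𝓝 0) := by
  have hb : ∀ i k, ‖⟪v i, z k⟫‖ ≤ C := fun i k ↦ by
    refine le_trans (Real.le_sqrt_of_sq_le ?_) (hz.sqrt_tsum_le hC (hv i))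
    exact (hz.summable (v i)).le_tsum k fun _ _ ↦ by positivity
  have h0 : ∀ i, Tendsto (fun k ↦ c i • (⟪v i, z k⟫ • u i)) atTop (𝓝 0) := fun i ↦ by
    have h1 : Tendsto (fun k ↦ ⟪v i, z k⟫) atTop (𝓝 0) := by
      rw [tendsto_zero_iff_norm_tendsto_zero]
      simpa using (hz.summable (v i)).tendsto_atTop_zero.sqrt
    simpa using (h1.smul_const (u i)).const_smul (c i)
  have := tendsto_tsum_of_dominated_convergence (𝓕 := atTop) (bound := fun i ↦ ‖c i‖ * C)
    (hc.mul_right C) h0 (Eventually.of_forall fun k i ↦ by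
      rw [norm_smul, norm_smul]
      gcongr
      exact (mul_le_of_le_one_right (norm_nonneg _) (hu i)).trans (hb i k))
  simpa [hT] using this

/-- The finite-time wave operators `e₂⁻ⁿ e₁ⁿ`. -/
noncomputable def waveSeq (e₁ e₂ : H ≃ₗᵢ[ℂ] H) (n : ℕ) : H ≃ₗᵢ[ℂ] H := (e₂ ^ n)⁻¹ * e₁ ^ n

lemma waveSeq_succ_sub (e₁ e₂ : H ≃ₗᵢ[ℂ] H) (n : ℕ) (x : H) :
    waveSeq e₁ e₂ (n + 1) x - waveSeq e₁ e₂ n x =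
      (e₂ ^ (n + 1))⁻¹ (((e₁ : H →L[ℂ] H) - (e₂ : H →L[ℂ] H)) ((e₁ ^ n) x)) := by
  have h₁ : waveSeq e₁ e₂ (n + 1) = (e₂ ^ (n + 1))⁻¹ * (e₁ * e₁ ^ n) := by
    rw [waveSeq, pow_succ' e₁]
  have h₂ : waveSeq e₁ e₂ n = (e₂ ^ (n + 1))⁻¹ * (e₂ * e₁ ^ n) := by
    rw [waveSeq]; group
  rw [h₁, h₂, sub_apply, map_sub]
  rfl

lemma inner_waveSeq_succ_sub (e₁ e₂ : H ≃ₗᵢ[ℂ] H) (n : ℕ) (x y : H) :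
    ⟪y, waveSeq e₁ e₂ (n + 1) x - waveSeq e₁ e₂ n x⟫ =
      ⟪(e₂ ^ (n + 1)) y, ((e₁ : H →L[ℂ] H) - (e₂ : H →L[ℂ] H)) ((e₁ ^ n) x)⟫ := by
  rw [waveSeq_succ_sub, ← (e₂ ^ (n + 1)).inner_map_map y]
  congr 1
  exact (e₂ ^ (n + 1)).apply_symm_apply _

lemma norm_waveSeq_sub_sq_le {e₁ e₂ : H ≃ₗᵢ[ℂ] H} (hu : ∀ i, ‖u i‖ ≤ 1) (hv : ∀ i, ‖v i‖ ≤ 1)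
    (hc : Summable fun i ↦ ‖c i‖)
    (hT : ∀ x, ((e₁ : H →L[ℂ] H) - (e₂ : H →L[ℂ] H)) x = ∑' i, c i • (⟪v i, x⟫ • u i))
    {x : H} {C : ℝ} (hC : 0 ≤ C) (hx : IsBesselSeq (fun k ↦ (e₁ ^ k) x) C) (n m : ℕ) :
    ‖waveSeq e₁ e₂ n x - waveSeq e₁ e₂ m x‖ ^ 2 ≤
      2 * (C * weightedTail c v (fun k ↦ (e₁ ^ k) x) n +
        C * weightedTail c v (fun k ↦ (e₁ ^ k) x) m) := by
  set W := waveSeq e₁ e₂ with hW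
  set r := weightedTail c v (fun k ↦ (e₁ ^ k) x) with hr
  let f : ℕ → ℂ := fun k ↦ ⟪W (n + k) x, W (m + k) x⟫
  have hsum : ∀ (a b : ℕ) (g : H ≃ₗᵢ[ℂ] H) (K : ℕ),
      (∀ k, e₂ ^ (a + k + 1) * W (b + k) = g * e₁ ^ k) →
      ∑ k ∈ Finset.range K, ‖⟪W (b + k) x, W (a + k + 1) x - W (a + k) x⟫‖ ≤ C * r a := by
    intro a b g K hg
    refine le_trans (Finset.sum_le_sum fun k _ ↦ ?_)
      (sum_norm_inner_nuclear_le hu hv hc hT hC hx hC (hx.map g) a K)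
    rw [inner_waveSeq_succ_sub, add_comm k a]
    have : (e₂ ^ (a + k + 1)) (W (b + k) x) = g ((e₁ ^ k) x) :=
      congrArg (fun e : H ≃ₗᵢ[ℂ] H ↦ e x) (hg k)
    rw [this]
  have hdiff : ∀ K, ‖f K - f 0‖ ≤ C * r n + C * r m := by
    intro K
    have h₁ : ∀ k, f (k + 1) - f k = ⟪W (n + k + 1) x - W (n + k) x, W (m + 1 + k) x⟫ +
        ⟪W (n + k) x, W (m + k + 1) x - W (m + k) x⟫ := fun k ↦ by
      rw [inner_sub_left, inner_sub_right, add_right_comm m 1 k]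
      simp only [f, ← add_assoc]
      ring
    rw [← Finset.sum_range_sub]
    have hA := hsum n (m + 1) (e₂ ^ n * (e₂ ^ m)⁻¹ * e₁ ^ (m + 1)) K fun k ↦ by
      simp only [hW, waveSeq, pow_add]
      group
    have hB := hsum m n (e₂ ^ (m + 1) * (e₂ ^ n)⁻¹ * e₁ ^ n) K fun k ↦ by
      simp only [hW, waveSeq, pow_add]
      group
    refine (norm_sum_le _ _).trans (le_trans (Finset.sum_le_sum fun k _ ↦ ?_)
      (Finset.sum_add_distrib.trans_le (add_le_add hA hB)))
    rw [h₁ k, norm_inner_symm (𝕜 := ℂ) (W (m + 1 + k) x)]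
    exact norm_add_le _ _
  have hshift : ∀ a, Tendsto (fun K ↦ W (a + K) x - W K x) atTop (𝓝 0) := by
    have hstep : Tendsto (fun K ↦ W (K + 1) x - W K x) atTop (𝓝 0) := by
      rw [tendsto_zero_iff_norm_tendsto_zero]
      simp only [hW, waveSeq_succ_sub, LinearIsometryEquiv.norm_map]
      simpa using (tendsto_nuclear_apply hu hv hc hT hC hx).norm
    intro a
    induction a with
    | zero => simp
    | succ a ih =>
      have := (hstep.comp (tendsto_add_atTop_nat a)).add ih
      rw [add_zero] at this
      refine this.congr fun K ↦ ?_
      simp only [Function.comp_apply]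
      rw [add_right_comm a 1 K, add_comm K a]
      abel
  have hlim : Tendsto f atTop (𝓝 ((‖x‖ ^ 2 : ℝ) : ℂ)) := by
    rw [tendsto_iff_norm_sub_tendsto_zero]
    have h₁ : Tendsto (fun K ↦ ‖W (n + K) x - W (m + K) x‖ * ‖x‖) atTop (𝓝 0) := by
      have := ((hshift n).sub (hshift m)).norm.mul_const ‖x‖
      simpa using this
    refine squeeze_zero (fun _ ↦ norm_nonneg _) (fun K ↦ ?_) h₁
    have h₂ : f K - ((‖x‖ ^ 2 : ℝ) : ℂ) = ⟪W (n + K) x - W (m + K) x, W (m + K) x⟫ := by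
      rw [inner_sub_left, inner_self_eq_norm_sq_to_K, LinearIsometryEquiv.norm_map]
      simp [f]
    rw [h₂]
    have := norm_inner_le_norm (𝕜 := ℂ) (W (n + K) x - W (m + K) x) (W (m + K) x)
    rwa [LinearIsometryEquiv.norm_map (W (m + K))] at this
  have hfin : ‖((‖x‖ ^ 2 : ℝ) : ℂ) - f 0‖ ≤ C * r n + C * r m :=
    le_of_tendsto ((hlim.sub_const _).norm) (Eventually.of_forall hdiff)
  have hre := (Complex.re_le_norm _).trans hfin
  rw [Complex.sub_re, Complex.ofReal_re] at hre
  rw [norm_sub_sq (𝕜 := ℂ), LinearIsometryEquiv.norm_map, LinearIsometryEquiv.norm_map]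
  change ‖x‖ ^ 2 - 2 * (f 0).re + ‖x‖ ^ 2 ≤ _
  linarith

lemma cauchySeq_waveSeq_of_isBesselSeq {e₁ e₂ : H ≃ₗᵢ[ℂ] H}
    (htr : IsTraceClass ((e₁ : H →L[ℂ] H) - (e₂ : H →L[ℂ] H))) {x : H} {C : ℝ} (hC : 0 ≤ C)
    (hx : IsBesselSeq (fun k ↦ (e₁ ^ k) x) C) : CauchySeq fun n ↦ waveSeq e₁ e₂ n x := by
  obtain ⟨c, u, v, hu, hv, hc, hT⟩ := htr
  rw [Metric.cauchySeq_iff]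
  intro ε hε
  have hr := (tendsto_weightedTail hv hc hC hx).const_mul C
  rw [mul_zero] at hr
  obtain ⟨N, hN⟩ := eventually_atTop.mp (hr.eventually_lt_const (show 0 < ε ^ 2 / 4 by positivity))
  refine ⟨N, fun n hn m hm ↦ ?_⟩
  rw [dist_eq_norm]
  refine lt_of_pow_lt_pow_left₀ 2 hε.le ?_
  linarith [norm_waveSeq_sub_sq_le hu hv hc hT hC hx n m, hN n hn, hN m hm]

end TraceClass

lemma cauchySeq_waveSeq {e₁ e₂ : H ≃ₗᵢ[ℂ] H}
    (htr : IsTraceClass ((e₁ : H →L[ℂ] H) - (e₂ : H →L[ℂ] H))) {x : H}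
    (hx : IsAcVector (e₁ : H →L[ℂ] H) x) : CauchySeq fun n ↦ waveSeq e₁ e₂ n x := by
  rw [Metric.cauchySeq_iff]
  intro ε hε
  obtain ⟨y, hy, C, hC, hB⟩ := exists_isBesselSeq_near hx (show 0 < ε / 3 by positivity)
  obtain ⟨N, hN⟩ := Metric.cauchySeq_iff.mp (cauchySeq_waveSeq_of_isBesselSeq htr hC hB) (ε / 3)
    (by positivity)
  refine ⟨N, fun n hn m hm ↦ ?_⟩
  have hd : ∀ k, dist (waveSeq e₁ e₂ k x) (waveSeq e₁ e₂ k y) < ε / 3 := fun k ↦ by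
    rwa [LinearIsometryEquiv.dist_map, dist_eq_norm]
  have h₁ := dist_triangle4 (waveSeq e₁ e₂ n x) (waveSeq e₁ e₂ n y) (waveSeq e₁ e₂ m y)
    (waveSeq e₁ e₂ m x)
  have h₂ := hd m
  rw [dist_comm] at h₂
  linarith [hd n, hN n hn m hm]

lemma tendsto_waveSeq_pow {e₁ e₂ : H ≃ₗᵢ[ℂ] H} {x w : H}
    (hw : Tendsto (fun n ↦ waveSeq e₁ e₂ n x) atTop (𝓝 w)) (k : ℕ) :
    Tendsto (fun n ↦ waveSeq e₁ e₂ n ((e₁ ^ k) x)) atTop (𝓝 ((e₂ ^ k) w)) := by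
  have h := ((e₂ ^ k).continuous.tendsto w).comp (hw.comp (tendsto_add_atTop_nat k))
  refine h.congr fun n ↦ ?_
  have : e₂ ^ k * waveSeq e₁ e₂ (n + k) = waveSeq e₁ e₂ n * e₁ ^ k := by
    simp only [waveSeq, pow_add]
    group
  exact congrArg (fun e : H ≃ₗᵢ[ℂ] H ↦ e x) this

lemma inner_pow_waveSeq_limit {e₁ e₂ : H ≃ₗᵢ[ℂ] H} {x w : H}
    (hw : Tendsto (fun n ↦ waveSeq e₁ e₂ n x) atTop (𝓝 w)) (k : ℕ) :
    ⟪w, (e₂ ^ k) w⟫ = ⟪x, (e₁ ^ k) x⟫ := by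
  refine tendsto_nhds_unique (hw.inner (tendsto_waveSeq_pow hw k)) ?_
  simp only [LinearIsometryEquiv.inner_map_map]
  exact tendsto_const_nhds

lemma inner_adjoint_pow (e : H ≃ₗᵢ[ℂ] H) (x : H) (k : ℕ) :
    ⟪x, (ContinuousLinearMap.adjoint (e : H →L[ℂ] H) ^ k) x⟫ =
      starRingEnd ℂ ⟪x, (e ^ k) x⟫ := by
  rw [← coe_pow_apply, inner_conj_symm, ← ContinuousLinearMap.star_eq_adjoint, ← star_pow,
    ContinuousLinearMap.star_eq_adjoint, ContinuousLinearMap.adjoint_inner_right]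

lemma acSpectrum_subset {e₁ e₂ : H ≃ₗᵢ[ℂ] H}
    (htr : IsTraceClass ((e₁ : H →L[ℂ] H) - (e₂ : H →L[ℂ] H))) :
    acSpectrum (e₁ : H →L[ℂ] H) ⊆ acSpectrum (e₂ : H →L[ℂ] H) := by
  intro z hz ε hε
  obtain ⟨x, hac, hx0, hx⟩ := hz ε hε
  obtain ⟨w, hw⟩ := cauchySeq_tendsto_of_complete (cauchySeq_waveSeq htr hac)
  have hnorm : ‖w‖ = ‖x‖ := by
    refine tendsto_nhds_unique hw.norm ?_
    simp only [LinearIsometryEquiv.norm_map]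
    exact tendsto_const_nhds
  have hsub : ‖e₂ w - z • w‖ = ‖e₁ x - z • x‖ := by
    have h := ((tendsto_waveSeq_pow hw 1).sub (hw.const_smul z)).norm
    refine tendsto_nhds_unique h ?_
    simp only [← map_smul, ← map_sub, LinearIsometryEquiv.norm_map, pow_one]
    exact tendsto_const_nhds
  refine ⟨w, ?_, by rwa [← norm_ne_zero_iff, hnorm, norm_ne_zero_iff], ?_⟩
  · obtain ⟨μ, hfin, hμ, hsupp, h⟩ := hac
    refine ⟨μ, hfin, hμ, hsupp, fun n ↦ ?_⟩
    have h' := h n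
    rw [inner_adjoint_pow, coe_pow_apply] at h' ⊢
    rwa [inner_pow_waveSeq_limit hw]
  · rw [hnorm]
    exact hsub.trans_lt hx

lemma IsTraceClass.sub_comm {S T : H →L[ℂ] H} (h : IsTraceClass (S - T)) :
    IsTraceClass (T - S) := by
  obtain ⟨c, u, v, hu, hv, hc, hT⟩ := h
  refine ⟨fun i ↦ -c i, u, v, hu, hv, by simpa using hc, fun x ↦ ?_⟩
  rw [← neg_sub, neg_apply, hT, ← tsum_neg]
  simp only [neg_smul]

theorem stmt_12 [TopologicalSpace.SeparableSpace H]
    (U₁ U₂ : H →L[ℂ] H) (hU₁ : U₁ ∈ unitary (H →L[ℂ] H)) (hU₂ : U₂ ∈ unitary (H →L[ℂ] H))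
    (htr : IsTraceClass (U₁ - U₂)) :
    acSpectrum U₁ = acSpectrum U₂ := by
  obtain ⟨e₁, rfl⟩ : ∃ e : H ≃ₗᵢ[ℂ] H, (e : H →L[ℂ] H) = U₁ :=
    ⟨Unitary.linearIsometryEquiv ⟨U₁, hU₁⟩, rfl⟩
  obtain ⟨e₂, rfl⟩ : ∃ e : H ≃ₗᵢ[ℂ] H, (e : H →L[ℂ] H) = U₂ :=
    ⟨Unitary.linearIsometryEquiv ⟨U₂, hU₂⟩, rfl⟩
  exact (acSpectrum_subset htr).antisymm (acSpectrum_subset htr.sub_comm)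
end
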